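/- Let N ≥ 1 be an integer and let m_1, …, m_N be positive real numbers with m_1 + ⋯ + m_N = 1. Then there exist a sequence (α_i)_{i≥1} with values in {1, …, N} and a constant A > 0 such that for every k ≥ 1 and every j ∈ {1, …, N} one has |N_{k,j} − k·m_j| ≤ A, where N_{k,j} denotes the number of indices 1 ≤ i ≤ k with α_i = j. -/

import Mathlib

/-- Greedily removing a unit from a largest coordinate keeps the accumulated deficits bounded. -/
theorem exists_greedy_deficits {ι : Type*} [Fintype ι] [Nonempty ι] [DecidableEq ι] (m : ι → ℝ)
    (hm : ∀ j, 0 ≤ m j) (hsum : ∑ j, m j = 1) :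
    ∃ (p : ℕ → ι) (d : ℕ → ι → ℝ), d 0 = 0 ∧
      (∀ k j, d (k + 1) j = d k j + m j - if p k = j then 1 else 0) ∧
      ∀ k j, |d k j| ≤ Fintype.card ι := by
  choose q hq using fun d : ι → ℝ => Finite.exists_max d
  let d : ℕ → ι → ℝ := fun k =>
    Nat.rec 0 (fun _ e j => e j + m j - if q e = j then 1 else 0) k
  have hd : ∀ k j, d (k + 1) j = d k j + m j - if q (d k) = j then 1 else 0 := fun _ _ => rfl
  have hzero : ∀ k, ∑ j, d k j = 0 := by
    intro k
    induction k with
    | zero => simp [d]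
    | succ k ih => simp [hd, Finset.sum_sub_distrib, Finset.sum_add_distrib, ih, hsum]
  have hlower : ∀ k j, -1 ≤ d k j := by
    intro k
    induction k with
    | zero => simp [d]
    | succ k ih =>
      intro j
      rw [hd]
      split_ifs with h
      · obtain ⟨i, -, hi⟩ := Finset.exists_le_of_sum_le (s := Finset.univ) (f := fun _ => (0 : ℝ))
          (g := d k) Finset.univ_nonempty (by simp [hzero])
        have := hq (d k) i
        rw [h] at this
        linarith [hm j]
      · linarith [hm j, ih j]
  refine ⟨fun k => q (d k), d, rfl, hd, fun k j => abs_le.2 ⟨?_, ?_⟩⟩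
  · have : (1 : ℝ) ≤ Fintype.card ι := by exact_mod_cast Fintype.card_pos (α := ι)
    linarith [hlower k j]
  · have := Finset.single_le_sum (f := fun i => d k i + 1)
      (fun i _ => by linarith [hlower k i]) (Finset.mem_univ j)
    simp [Finset.sum_add_distrib, hzero] at this
    linarith

theorem walsh_balanced_sequence_exists
    (N : ℕ) (hN : 1 ≤ N) (m : Fin N → ℝ) (hm : ∀ j, 0 < m j)
    (hsum : ∑ j, m j = 1) :
    ∃ (α : ℕ → Fin N) (A : ℝ), 0 < A ∧
      ∀ k : ℕ, 1 ≤ k → ∀ j : Fin N,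
        |((((Finset.Icc 1 k).filter (fun i => α i = j)).card : ℝ) - (k : ℝ) * m j)| ≤ A := by
  have : Nonempty (Fin N) := ⟨⟨0, hN⟩⟩
  obtain ⟨p, d, hd0, hd, hbound⟩ := exists_greedy_deficits m (fun j => (hm j).le) hsum
  have hcount : ∀ (k : ℕ) (j : Fin N),
      (((Finset.Icc 1 k).filter (fun i => p (i - 1) = j)).card : ℝ) = k * m j - d k j := by
    intro k j
    induction k with
    | zero => simp [hd0]
    | succ k ih =>
      rw [← Finset.insert_Icc_right_eq_Icc_add_one (by omega), Finset.filter_insert, hd]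
      split_ifs with h h' h'
      · rw [Finset.card_insert_of_notMem (by simp)]
        push_cast
        rw [ih]
        ring
      · exact absurd h h'
      · exact absurd h' h
      · rw [ih]
        push_cast
        ring
  refine ⟨fun i => p (i - 1), N, by exact_mod_cast hN, fun k _ j => ?_⟩
  rw [hcount, sub_sub_cancel_left, abs_neg]
  simpa using hbound k j
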